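/- Let 1 < p < 2, β > 0, μ₁, μ₂ ∈ ℝ, and c₁, c₂ > 0. Then there exists M > 0 such that I(u,v) ≥ −M for every pair (u,v) admissible for (c₁,c₂). -/

import Mathlib

open MeasureTheory

noncomputable section

abbrev Plane := EuclideanSpace ℝ (Fin 2)

/-- A pair `(u,v)` is admissible for masses `(c₁,c₂)`: `C¹`, in `L² ∩ L^{2p}` with the
prescribed `L²` masses, finite Dirichlet energy, finite `log(1+|x|)`-weighted `L²` norm,
and integrable logarithmic interaction kernel.  (In Lean, `Real.log 0 = 0`, so the
integrand `log ‖x−y‖ ⋯` is interpreted as `0` on the diagonal.) -/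
def Admissible (p c₁ c₂ : ℝ) (u v : Plane → ℝ) : Prop :=
  ContDiff ℝ 1 u ∧ ContDiff ℝ 1 v ∧
  Integrable (fun x => (u x) ^ 2) ∧ Integrable (fun x => (v x) ^ 2) ∧
  Integrable (fun x => |u x| ^ (2 * p)) ∧ Integrable (fun x => |v x| ^ (2 * p)) ∧
  (∫ x, (u x) ^ 2) = c₁ ∧ (∫ x, (v x) ^ 2) = c₂ ∧
  Integrable (fun x => ‖gradient u x‖ ^ 2 + ‖gradient v x‖ ^ 2) ∧
  Integrable (fun x => Real.log (1 + ‖x‖) * ((u x) ^ 2 + (v x) ^ 2)) ∧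
  Integrable (fun z : Plane × Plane =>
    Real.log ‖z.1 - z.2‖ * ((u z.1) ^ 2 + (v z.1) ^ 2) * ((u z.2) ^ 2 + (v z.2) ^ 2))

/-- The energy functional `I(u,v)`. -/
def energy (p μ₁ μ₂ β : ℝ) (u v : Plane → ℝ) : ℝ :=
  (1 / 2) * (∫ x, ‖gradient u x‖ ^ 2 + ‖gradient v x‖ ^ 2) +
  (1 / 4) * (∫ z : Plane × Plane,
    Real.log ‖z.1 - z.2‖ * ((u z.1) ^ 2 + (v z.1) ^ 2) * ((u z.2) ^ 2 + (v z.2) ^ 2)) -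
  (1 / (2 * p)) * (μ₁ * (∫ x, |u x| ^ (2 * p)) + μ₂ * (∫ x, |v x| ^ (2 * p)) +
    2 * β * (∫ x, |u x * v x| ^ p))

/-- Smooth cutoffs exhausting the plane, with uniformly bounded derivatives. -/
lemma exists_cutoff : ∃ K : ℝ, 0 ≤ K ∧ ∃ χ : ℕ → Plane → ℝ, ∀ n, ContDiff ℝ 1 (χ n) ∧
    HasCompactSupport (χ n) ∧ (∀ x, |χ n x| ≤ 1) ∧ (∀ x, ‖fderiv ℝ (χ n) x‖ ≤ K) ∧
    ∀ x, ‖x‖ ≤ n → χ n x = 1 := by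
  let φ : ContDiffBump (0 : Plane) := ⟨1, 2, one_pos, one_lt_two⟩
  have hφ : ContDiff ℝ 1 φ := φ.contDiff
  obtain ⟨K, hK⟩ := (hφ.continuous_fderiv one_ne_zero).bounded_above_of_compact_support
    (φ.hasCompactSupport.fderiv (𝕜 := ℝ))
  have hK0 : 0 ≤ K := (norm_nonneg _).trans (hK 0)
  refine ⟨K, hK0, fun n x => φ (((n : ℝ) + 1)⁻¹ • x), fun n => ?_⟩
  have hn : (0 : ℝ) < (n : ℝ) + 1 := by positivity
  refine ⟨hφ.comp (contDiff_const_smul _), ?_, fun x => ?_, fun x => ?_, fun x hx => ?_⟩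
  · exact φ.hasCompactSupport.comp_smul (inv_ne_zero hn.ne')
  · rw [abs_of_nonneg φ.nonneg]
    exact φ.le_one
  · rw [fderiv_comp_smul, norm_smul, Real.norm_of_nonneg (by positivity)]
    calc ((n : ℝ) + 1)⁻¹ * ‖fderiv ℝ φ (((n : ℝ) + 1)⁻¹ • x)‖ ≤ 1 * K := by
          gcongr
          · exact inv_le_one_of_one_le₀ (by simp)
          · exact hK _
      _ = K := one_mul K
  · apply φ.one_of_mem_closedBall
    rw [mem_closedBall_zero_iff, norm_smul, Real.norm_of_nonneg (by positivity)]
    change _ ≤ (1 : ℝ)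
    rw [inv_mul_le_iff₀ hn]
    linarith

/-- A weak form of Ladyzhenskaya's inequality in the plane. -/
lemma exists_integral_pow_four_le (c : ℝ) (hc : 0 < c) : ∃ A : ℝ, 0 ≤ A ∧ ∀ u : Plane → ℝ,
    ContDiff ℝ 1 u → Integrable (fun x => u x ^ 2) → ∫ x, u x ^ 2 = c →
    Integrable (fun x => ‖fderiv ℝ u x‖ ^ 2) →
    Integrable (fun x => u x ^ 4) ∧ ∫ x, u x ^ 4 ≤ A * (1 + ∫ x, ‖fderiv ℝ u x‖ ^ 2) := by
  obtain ⟨K, hK0, χ, hχ⟩ := exists_cutoff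
  set C := lintegralPowLePowLIntegralFDerivConst (volume : Measure Plane) 2
  refine ⟨C * (c + 1 + K * c) ^ 2, by positivity, fun u hu hu2 huc hg => ?_⟩
  set D := ∫ x, ‖fderiv ℝ u x‖ ^ 2 with hD
  have hD0 : 0 ≤ D := integral_nonneg fun x => by positivity
  set l := √(1 + D) with hl
  have hl2 : l ^ 2 = 1 + D := Real.sq_sqrt (by positivity)
  have hl1 : 1 ≤ l := Real.one_le_sqrt.2 (by linarith)
  have hl0 : 0 < l := by linarith
  set h : Plane → ℝ := fun x => (l + K) * u x ^ 2 + l⁻¹ * ‖fderiv ℝ u x‖ ^ 2 with hh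
  have hint : Integrable h := (hu2.const_mul _).add (hg.const_mul _)
  have hh0 : ∀ x, 0 ≤ h x := fun x => by positivity
  have hhint : ∫ x, h x ≤ l * (c + 1 + K * c) := by
    rw [hh, integral_add (hu2.const_mul _) (hg.const_mul _), integral_const_mul,
      integral_const_mul, huc, ← hD]
    have h1 : l⁻¹ * D ≤ l := by
      rw [inv_mul_le_iff₀ hl0]
      nlinarith
    nlinarith [mul_nonneg (mul_nonneg hK0 hc.le) (sub_nonneg.2 hl1)]
  set B : ℝ := C * (l * (c + 1 + K * c)) ^ 2 with hB
  have hbound : ∀ n, ∫⁻ x, ENNReal.ofReal ((χ n x * u x ^ 2) ^ 2) ≤ ENNReal.ofReal B := by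
    intro n
    obtain ⟨h1, h2, h3, h4, -⟩ := hχ n
    have hf : ContDiff ℝ 1 (fun x => χ n x * u x ^ 2) := h1.mul (hu.pow 2)
    have hcs : HasCompactSupport (fun x => χ n x * u x ^ 2) := h2.mul_right
    have key := lintegral_pow_le_pow_lintegral_fderiv (volume : Measure Plane) hf hcs (p := 2)
      (by
        rw [finrank_euclideanSpace_fin]
        exact_mod_cast Real.HolderConjugate.two_two)
    have hder : ∀ x, ‖fderiv ℝ (fun x => χ n x * u x ^ 2) x‖ ≤ h x := by
      intro x
      have hd := ((h1.differentiable one_ne_zero x).hasFDerivAt.mul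
        ((hu.differentiable one_ne_zero x).hasFDerivAt.pow 2)).fderiv
      have e : (fun x => χ n x * u x ^ 2) = χ n * fun x => u x ^ 2 := rfl
      rw [e, hd]
      refine (norm_add_le _ _).trans ?_
      simp only [norm_smul, Nat.add_one_sub_one, pow_one, nsmul_eq_mul, Nat.cast_ofNat,
        norm_mul, Real.norm_eq_abs, abs_pow, sq_abs, Nat.abs_ofNat]
      have e1 : |χ n x| * (2 * |u x| * ‖fderiv ℝ u x‖) ≤ 1 * (2 * |u x| * ‖fderiv ℝ u x‖) := by
        gcongr
        exact h3 x
      have e2 : u x ^ 2 * ‖fderiv ℝ (χ n) x‖ ≤ u x ^ 2 * K := by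
        gcongr
        exact h4 x
      have e3 : 2 * |u x| * ‖fderiv ℝ u x‖ ≤ l * u x ^ 2 + l⁻¹ * ‖fderiv ℝ u x‖ ^ 2 := by
        have := mul_nonneg (inv_pos.2 hl0).le (sq_nonneg (l * |u x| - ‖fderiv ℝ u x‖))
        have e4 : l⁻¹ * (l * |u x| - ‖fderiv ℝ u x‖) ^ 2
            = l * u x ^ 2 + l⁻¹ * ‖fderiv ℝ u x‖ ^ 2 - 2 * |u x| * ‖fderiv ℝ u x‖ := by
          rw [← sq_abs (u x)]
          field_simp
          ring
        linarith
      simp only [hh]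
      linarith
    have hlint : ∫⁻ x, ‖fderiv ℝ (fun x => χ n x * u x ^ 2) x‖ₑ
        ≤ ENNReal.ofReal (l * (c + 1 + K * c)) := by
      calc _ ≤ ∫⁻ x, ENNReal.ofReal (h x) := by
            refine lintegral_mono fun x => ?_
            rw [← ofReal_norm]
            exact ENNReal.ofReal_le_ofReal (hder x)
        _ = ENNReal.ofReal (∫ x, h x) :=
            (ofReal_integral_eq_lintegral_ofReal hint (ae_of_all _ hh0)).symm
        _ ≤ _ := ENNReal.ofReal_le_ofReal hhint
    calc _ = ∫⁻ x, ‖χ n x * u x ^ 2‖ₑ ^ (2 : ℝ) := by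
          refine lintegral_congr fun x => ?_
          rw [← ofReal_norm, ENNReal.rpow_two, ← ENNReal.ofReal_pow (norm_nonneg _),
            Real.norm_eq_abs, sq_abs]
      _ ≤ _ := key
      _ ≤ C * ENNReal.ofReal (l * (c + 1 + K * c)) ^ (2 : ℝ) := by gcongr
      _ = ENNReal.ofReal B := by
          rw [ENNReal.rpow_two, ← ENNReal.ofReal_pow (by positivity), hB,
            ENNReal.ofReal_mul (by positivity), ENNReal.ofReal_coe_nnreal]
  have hfatou : ∫⁻ x, ENNReal.ofReal (u x ^ 4) ≤ ENNReal.ofReal B := by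
    have hlim : ∀ x, Filter.liminf (fun n => ENNReal.ofReal ((χ n x * u x ^ 2) ^ 2)) Filter.atTop
        = ENNReal.ofReal (u x ^ 4) := by
      intro x
      refine (tendsto_const_nhds.congr' ?_).liminf_eq
      obtain ⟨N, hN⟩ := exists_nat_ge ‖x‖
      filter_upwards [Filter.eventually_ge_atTop N] with n hn
      rw [(hχ n).2.2.2.2 x (hN.trans (by exact_mod_cast hn)), one_mul, ← pow_mul]
    simp_rw [← hlim]
    refine (lintegral_liminf_le fun n => ?_).trans ?_
    · exact (((hχ n).1.continuous.mul (hu.continuous.pow 2)).pow 2).measurable.ennreal_ofReal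
    · exact Filter.liminf_le_of_le (by isBoundedDefault) fun b hb => by
        obtain ⟨n, hn⟩ := hb.exists
        exact hn.trans (hbound n)
  have h4 : Integrable (fun x => u x ^ 4) := by
    refine ⟨(hu.continuous.pow 4).aestronglyMeasurable, ?_⟩
    rw [hasFiniteIntegral_iff_ofReal (ae_of_all _ fun x => by positivity)]
    exact hfatou.trans_lt ENNReal.ofReal_lt_top
  refine ⟨h4, ?_⟩
  rw [← ofReal_integral_eq_lintegral_ofReal h4 (ae_of_all _ fun x => by positivity)] at hfatou
  rw [ENNReal.ofReal_le_ofReal_iff (by positivity)] at hfatou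
  rwa [hB, mul_pow, hl2, mul_comm (1 + D), ← mul_assoc] at hfatou

/-- The singular part of the logarithmic kernel. -/
def logSing (z : Plane) : ℝ := max 0 (-Real.log ‖z‖)

lemma logSing_nonneg (z : Plane) : 0 ≤ logSing z := le_max_left _ _

lemma integrable_logSing : Integrable logSing := by
  refine (integrable_fun_norm_addHaar (volume : Measure Plane)
    (f := fun y => max 0 (-Real.log y))).2 ?_
  rw [finrank_euclideanSpace_fin]
  have h1 : IntegrableOn (Set.indicator (Set.Ioc 0 1) fun _ : ℝ => (1 : ℝ)) (Set.Ioi 0) :=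
    ((integrable_indicator_iff measurableSet_Ioc).2 (by simp)).integrableOn
  refine Integrable.mono' h1 (by fun_prop) ?_
  filter_upwards [ae_restrict_mem measurableSet_Ioi] with y hy
  have hy0 : 0 < y := hy
  simp only [Nat.add_one_sub_one, pow_one, smul_eq_mul]
  rw [Real.norm_of_nonneg (by positivity)]
  by_cases hy1 : y ≤ 1
  · rw [Set.indicator_of_mem (Set.mem_Ioc.2 ⟨hy0, hy1⟩), max_eq_right
      (neg_nonneg.2 (Real.log_nonpos hy0.le hy1))]
    have := (abs_lt.1 (Real.abs_log_mul_self_lt y hy0 hy1)).1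
    linarith
  · rw [Set.indicator_of_notMem (fun h => hy1 h.2), max_eq_left
      (neg_nonpos.2 (Real.log_nonneg (not_le.1 hy1).le)), mul_zero]

/-- Splitting of the logarithmic kernel at the scale `r`. -/
lemma log_sub_logSing_le_log {r : ℝ} (hr : 0 < r) (hr1 : r ≤ 1) (z : Plane) :
    Real.log r - logSing (r⁻¹ • z) ≤ Real.log ‖z‖ := by
  rcases eq_or_ne z 0 with rfl | hz
  · have := Real.log_nonpos hr.le hr1
    have := logSing_nonneg (r⁻¹ • 0)
    rw [norm_zero, Real.log_zero]
    linarith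
  · have h : -Real.log ‖r⁻¹ • z‖ ≤ logSing (r⁻¹ • z) := le_max_right _ _
    rw [norm_smul, Real.norm_of_nonneg (by positivity),
      Real.log_mul (by positivity) (norm_ne_zero_iff.2 hz), Real.log_inv] at h
    linarith

/-- Lower bound for the logarithmic interaction energy of a density `w`, with an arbitrarily
small multiple of `∫ w²`. -/
lemma exists_le_integral_log (ε : ℝ) (hε : 0 < ε) : ∃ L : ℝ, 0 ≤ L ∧ ∀ w : Plane → ℝ,
    (∀ x, 0 ≤ w x) → Integrable w → Integrable (fun x => w x ^ 2) →
    Integrable (fun z : Plane × Plane => Real.log ‖z.1 - z.2‖ * w z.1 * w z.2) →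
    -L * (∫ x, w x) ^ 2 - ε * ∫ x, w x ^ 2 ≤
      ∫ z : Plane × Plane, Real.log ‖z.1 - z.2‖ * w z.1 * w z.2 := by
  set κ := ∫ z, logSing z with hκ
  have hκ0 : 0 ≤ κ := integral_nonneg logSing_nonneg
  set r := min 1 (ε / (κ + 1)) with hr
  have hr0 : 0 < r := by positivity
  have hr1 : r ≤ 1 := min_le_left _ _
  have hrκ : r ^ 2 * κ ≤ ε := by
    have h1 : r ≤ ε / (κ + 1) := min_le_right _ _
    rw [le_div_iff₀ (by positivity)] at h1
    nlinarith [mul_nonneg (mul_nonneg hr0.le hκ0) (sub_nonneg.2 hr1)]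
  refine ⟨-Real.log r, neg_nonneg.2 (Real.log_nonpos hr0.le hr1), fun w hw hw1 hw2 hlog => ?_⟩
  have hk : Integrable (fun z => logSing (r⁻¹ • z)) :=
    integrable_logSing.comp_smul (inv_ne_zero hr0.ne')
  have hkint : ∫ z, logSing (r⁻¹ • z) = r ^ 2 * κ := by
    rw [Measure.integral_comp_inv_smul_of_nonneg volume logSing hr0.le,
      finrank_euclideanSpace_fin, smul_eq_mul]
  have hww : Integrable (fun z : Plane × Plane => w z.1 * w z.2) := hw1.mul_prod hw1
  have hwwint : ∫ z : Plane × Plane, w z.1 * w z.2 = (∫ x, w x) ^ 2 := by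
    rw [sq]
    exact integral_prod_mul w w
  have hprod : Integrable (fun z : Plane × Plane => logSing (r⁻¹ • z.1) * w z.2 ^ 2) :=
    hk.mul_prod hw2
  have hprodint : ∫ z : Plane × Plane, logSing (r⁻¹ • z.1) * w z.2 ^ 2
      = r ^ 2 * κ * ∫ x, w x ^ 2 := by
    rw [← hkint]
    exact integral_prod_mul (fun z => logSing (r⁻¹ • z)) (fun x => w x ^ 2)
  have hcomp : ∀ T : Plane × Plane → Plane × Plane, MeasurePreserving T →
      Integrable (fun z => logSing (r⁻¹ • (T z).1) * w (T z).2 ^ 2) ∧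
      ∫ z, logSing (r⁻¹ • (T z).1) * w (T z).2 ^ 2 = r ^ 2 * κ * ∫ x, w x ^ 2 := by
    refine fun T hT => ⟨hT.integrable_comp_of_integrable hprod, ?_⟩
    rw [← hprodint, ← integral_map (μ := volume) hT.aemeasurable
      (f := fun z : Plane × Plane => logSing (r⁻¹ • z.1) * w z.2 ^ 2)
      (by rw [hT.map_eq]; exact hprod.aestronglyMeasurable), hT.map_eq]
  obtain ⟨hi1, he1⟩ := hcomp (fun z => (z.1 - z.2, z.2)) (measurePreserving_sub_prod volume volume)
  obtain ⟨hi2, he2⟩ := hcomp (fun z => (z.2 - z.1, z.1))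
    ((measurePreserving_sub_prod volume volume).comp Measure.measurePreserving_swap)
  dsimp only at hi1 he1 hi2 he2
  have hi12 : Integrable (fun z : Plane × Plane =>
      1 / 2 * (logSing (r⁻¹ • (z.1 - z.2)) * w z.2 ^ 2)
        + 1 / 2 * (logSing (r⁻¹ • (z.2 - z.1)) * w z.1 ^ 2)) :=
    (hi1.const_mul _).add (hi2.const_mul _)
  have hle : ∀ z : Plane × Plane, Real.log r * (w z.1 * w z.2)
      - (1 / 2 * (logSing (r⁻¹ • (z.1 - z.2)) * w z.2 ^ 2)
        + 1 / 2 * (logSing (r⁻¹ • (z.2 - z.1)) * w z.1 ^ 2))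
      ≤ Real.log ‖z.1 - z.2‖ * w z.1 * w z.2 := by
    intro z
    have h1 := log_sub_logSing_le_log hr0 hr1 (z.1 - z.2)
    have h2 : logSing (r⁻¹ • (z.2 - z.1)) = logSing (r⁻¹ • (z.1 - z.2)) := by
      rw [← neg_sub, smul_neg, logSing, logSing, norm_neg]
    have h3 := mul_le_mul_of_nonneg_right h1 (mul_nonneg (hw z.1) (hw z.2))
    have h4 := mul_nonneg (logSing_nonneg (r⁻¹ • (z.1 - z.2))) (sq_nonneg (w z.1 - w z.2))
    rw [h2]
    linarith
  have hmono := integral_mono ((hww.const_mul (Real.log r)).sub hi12) hlog hle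
  have hsum : ∫ z : Plane × Plane, (Real.log r * (w z.1 * w z.2)
      - (1 / 2 * (logSing (r⁻¹ • (z.1 - z.2)) * w z.2 ^ 2)
        + 1 / 2 * (logSing (r⁻¹ • (z.2 - z.1)) * w z.1 ^ 2)))
      = Real.log r * (∫ x, w x) ^ 2 - r ^ 2 * κ * ∫ x, w x ^ 2 := by
    rw [integral_sub (hww.const_mul _) hi12,
      integral_add (hi1.const_mul _) (hi2.const_mul _), integral_const_mul, integral_const_mul,
      integral_const_mul, hwwint, he1, he2]
    ring
  have hw2n : 0 ≤ ∫ x, w x ^ 2 := integral_nonneg fun x => sq_nonneg _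
  have := mul_le_mul_of_nonneg_right hrκ hw2n
  have hmono' := hsum.symm.trans_le hmono
  linarith

/-- Young-type interpolation of the power `2p` between the powers `2` and `4`. -/
lemma exists_abs_rpow_le {p : ℝ} (hp₁ : 1 < p) (hp₂ : p < 2) {ε : ℝ} (hε : 0 < ε) :
    ∃ C : ℝ, 0 ≤ C ∧ ∀ t : ℝ, |t| ^ (2 * p) ≤ ε * t ^ 4 + C * t ^ 2 := by
  set T := ε ^ (p - 2)⁻¹ with hT
  have hT0 : 0 < T := Real.rpow_pos_of_pos hε _
  have hTε : T ^ (p - 2) = ε := Real.rpow_inv_rpow hε.le (by linarith)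
  refine ⟨T ^ (p - 1), by positivity, fun t => ?_⟩
  rw [Real.rpow_mul (abs_nonneg t), Real.rpow_two, sq_abs]
  rcases eq_or_ne t 0 with rfl | ht
  · simp [Real.zero_rpow (by linarith : p ≠ 0)]
  have hs : 0 < t ^ 2 := by positivity
  rcases le_total (t ^ 2) T with h | h
  · have h1 : (t ^ 2) ^ p = (t ^ 2) ^ (p - 1) * t ^ 2 := by
      rw [← Real.rpow_add_one hs.ne', sub_add_cancel]
    have h2 : (t ^ 2) ^ (p - 1) ≤ T ^ (p - 1) := Real.rpow_le_rpow hs.le h (by linarith)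
    have h3 := mul_le_mul_of_nonneg_right h2 hs.le
    have h4 : 0 ≤ ε * t ^ 4 := by positivity
    linarith
  · have h1 : (t ^ 2) ^ p = (t ^ 2) ^ (p - 2) * t ^ 4 := by
      rw [show t ^ 4 = (t ^ 2) ^ (2 : ℝ) by rw [Real.rpow_two]; ring, ← Real.rpow_add hs,
        sub_add_cancel]
    have h2 : (t ^ 2) ^ (p - 2) ≤ ε :=
      hTε ▸ Real.rpow_le_rpow_of_nonpos hT0 h (by linarith)
    have h3 := mul_le_mul_of_nonneg_right h2 (by positivity : 0 ≤ t ^ 4)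
    have h4 : 0 ≤ T ^ (p - 1) * t ^ 2 := by positivity
    linarith

lemma norm_gradient_eq (u : Plane → ℝ) (x : Plane) : ‖gradient u x‖ = ‖fderiv ℝ u x‖ := by
  rw [← toDual_gradient, LinearIsometryEquiv.norm_map]

lemma two_mul_abs_mul_rpow_le (a b p : ℝ) :
    2 * |a * b| ^ p ≤ |a| ^ (2 * p) + |b| ^ (2 * p) := by
  rw [abs_mul, Real.mul_rpow (abs_nonneg a) (abs_nonneg b), mul_comm 2 p,
    Real.rpow_mul (abs_nonneg a), Real.rpow_mul (abs_nonneg b), Real.rpow_two, Real.rpow_two]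
  linarith [two_mul_le_add_sq (|a| ^ p) (|b| ^ p)]

/-- For `1 < p < 2` (mass-subcritical case) and `β > 0`, the energy is bounded from below
on the constraint set. -/
theorem stmt12 (p β μ₁ μ₂ c₁ c₂ : ℝ) (hp₁ : 1 < p) (hp₂ : p < 2) (hβ : 0 < β)
    (hc₁ : 0 < c₁) (hc₂ : 0 < c₂) :
    ∃ M : ℝ, 0 < M ∧ ∀ u v : Plane → ℝ, Admissible p c₁ c₂ u v →
      -M ≤ energy p μ₁ μ₂ β u v := by
  obtain ⟨A₁, hA₁, hGN₁⟩ := exists_integral_pow_four_le c₁ hc₁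
  obtain ⟨A₂, hA₂, hGN₂⟩ := exists_integral_pow_four_le c₂ hc₂
  set m := |μ₁| + |μ₂| + β with hm
  have hm0 : 0 < m := by positivity
  set ε := 1 / ((1 + 2 * m) * (A₁ + A₂ + 1)) with hε
  have hε0 : 0 < ε := by positivity
  obtain ⟨C, hC, hY⟩ := exists_abs_rpow_le hp₁ hp₂ hε0
  obtain ⟨L, hL, hlog⟩ := exists_le_integral_log ε hε0
  refine ⟨1 + L * (c₁ + c₂) ^ 2 + m * (C * (c₁ + c₂)), by positivity, ?_⟩
  rintro u v ⟨hu, hv, hu2, hv2, hup, hvp, huc, hvc, hgrad, -, hker⟩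
  simp only [energy]
  simp only [norm_gradient_eq] at hgrad ⊢
  have hgu : Integrable (fun x => ‖fderiv ℝ u x‖ ^ 2) := by
    refine hgrad.mono' ((hu.continuous_fderiv one_ne_zero).norm.pow 2).aestronglyMeasurable
      (ae_of_all _ fun x => ?_)
    rw [Real.norm_of_nonneg (by positivity)]
    linarith [sq_nonneg ‖fderiv ℝ v x‖]
  have hgv : Integrable (fun x => ‖fderiv ℝ v x‖ ^ 2) := by
    refine hgrad.mono' ((hv.continuous_fderiv one_ne_zero).norm.pow 2).aestronglyMeasurable
      (ae_of_all _ fun x => ?_)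
    rw [Real.norm_of_nonneg (by positivity)]
    linarith [sq_nonneg ‖fderiv ℝ u x‖]
  obtain ⟨hu4, hu4le⟩ := hGN₁ u hu hu2 huc hgu
  obtain ⟨hv4, hv4le⟩ := hGN₂ v hv hv2 hvc hgv
  have hw : Integrable (fun x => u x ^ 2 + v x ^ 2) := hu2.add hv2
  have hwint : ∫ x, (u x ^ 2 + v x ^ 2) = c₁ + c₂ := by rw [integral_add hu2 hv2, huc, hvc]
  have hwle : ∀ x, (u x ^ 2 + v x ^ 2) ^ 2 ≤ 2 * u x ^ 4 + 2 * v x ^ 4 := fun x => by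
    nlinarith [sq_nonneg (u x ^ 2 - v x ^ 2)]
  have hw4 : Integrable (fun x => 2 * u x ^ 4 + 2 * v x ^ 4) :=
    (hu4.const_mul 2).add (hv4.const_mul 2)
  have hw2 : Integrable (fun x => (u x ^ 2 + v x ^ 2) ^ 2) := by
    refine hw4.mono' (((hu.continuous.pow 2).add (hv.continuous.pow 2)).pow 2).aestronglyMeasurable
      (ae_of_all _ fun x => ?_)
    rw [Real.norm_of_nonneg (by positivity)]
    exact hwle x
  have hw2le : ∫ x, (u x ^ 2 + v x ^ 2) ^ 2 ≤ 2 * (∫ x, u x ^ 4) + 2 * ∫ x, v x ^ 4 := by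
    have := integral_mono hw2 hw4 hwle
    rwa [integral_add (hu4.const_mul 2) (hv4.const_mul 2), integral_const_mul,
      integral_const_mul] at this
  have hlog' := hlog _ (fun x => by positivity) hw hw2 hker
  rw [hwint] at hlog'
  have hpow : ∀ f : Plane → ℝ, Integrable (fun x => f x ^ 2) → Integrable (fun x => f x ^ 4) →
      Integrable (fun x => |f x| ^ (2 * p)) →
      ∫ x, |f x| ^ (2 * p) ≤ ε * (∫ x, f x ^ 4) + C * ∫ x, f x ^ 2 := by
    intro f h2 h4 hp
    rw [← integral_const_mul, ← integral_const_mul,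
      ← integral_add (h4.const_mul _) (h2.const_mul _)]
    exact integral_mono hp ((h4.const_mul _).add (h2.const_mul _)) fun x => hY (f x)
  have hup' := hpow u hu2 hu4 hup
  have hvp' := hpow v hv2 hv4 hvp
  rw [huc] at hup'
  rw [hvc] at hvp'
  have huv : 2 * ∫ x, |u x * v x| ^ p ≤ (∫ x, |u x| ^ (2 * p)) + ∫ x, |v x| ^ (2 * p) := by
    rw [← integral_const_mul, ← integral_add hup hvp]
    exact integral_mono_of_nonneg (ae_of_all _ fun x => by positivity) (hup.add hvp)
      (ae_of_all _ fun x => two_mul_abs_mul_rpow_le _ _ _)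
  have hP₁ : 0 ≤ ∫ x, |u x| ^ (2 * p) := integral_nonneg fun x => by positivity
  have hP₂ : 0 ≤ ∫ x, |v x| ^ (2 * p) := integral_nonneg fun x => by positivity
  have hQ₁ : 0 ≤ ∫ x, u x ^ 4 := integral_nonneg fun x => by positivity
  have hQ₂ : 0 ≤ ∫ x, v x ^ 4 := integral_nonneg fun x => by positivity
  have hD₁ : 0 ≤ ∫ x, ‖fderiv ℝ u x‖ ^ 2 := integral_nonneg fun x => by positivity
  have hD₂ : 0 ≤ ∫ x, ‖fderiv ℝ v x‖ ^ 2 := integral_nonneg fun x => by positivity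
  rw [integral_add hgu hgv]
  set Du := ∫ x, ‖fderiv ℝ u x‖ ^ 2
  set Dv := ∫ x, ‖fderiv ℝ v x‖ ^ 2
  set Qu := ∫ x, u x ^ 4
  set Qv := ∫ x, v x ^ 4
  set Pu := ∫ x, |u x| ^ (2 * p)
  set Pv := ∫ x, |v x| ^ (2 * p)
  set R := ∫ x, |u x * v x| ^ p
  set W := ∫ x, (u x ^ 2 + v x ^ 2) ^ 2
  set J := ∫ z : Plane × Plane,
    Real.log ‖z.1 - z.2‖ * ((u z.1) ^ 2 + (v z.1) ^ 2) * ((u z.2) ^ 2 + (v z.2) ^ 2)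
  have hN : μ₁ * Pu + μ₂ * Pv + 2 * β * R ≤ m * (Pu + Pv) := by
    have h1 := mul_le_mul_of_nonneg_right (le_abs_self μ₁) hP₁
    have h2 := mul_le_mul_of_nonneg_right (le_abs_self μ₂) hP₂
    have h3 := mul_le_mul_of_nonneg_left huv hβ.le
    have h4 := mul_nonneg (abs_nonneg μ₁) hP₂
    have h5 := mul_nonneg (abs_nonneg μ₂) hP₁
    rw [hm]
    linarith
  have hN' : 1 / (2 * p) * (μ₁ * Pu + μ₂ * Pv + 2 * β * R) ≤ m * (Pu + Pv) := by
    have h1 : 1 / (2 * p) ≤ 1 := by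
      rw [div_le_one (by positivity)]
      linarith
    calc _ ≤ 1 / (2 * p) * (m * (Pu + Pv)) := by gcongr
      _ ≤ 1 * (m * (Pu + Pv)) := by gcongr
      _ = _ := one_mul _
  have hmP := mul_le_mul_of_nonneg_left (add_le_add hup' hvp') hm0.le
  have hQ : Qu + Qv ≤ (A₁ + A₂ + 1) * (2 + Du + Dv) := by
    have h1 := mul_nonneg hA₁ hD₂
    have h2 := mul_nonneg hA₂ hD₁
    linarith
  have hεQ : ε * (1 + 2 * m) * (Qu + Qv) ≤ 2 + Du + Dv := by
    calc ε * (1 + 2 * m) * (Qu + Qv)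
        ≤ ε * (1 + 2 * m) * ((A₁ + A₂ + 1) * (2 + Du + Dv)) := by gcongr
      _ = 2 + Du + Dv := by
        rw [hε]
        field_simp
  have hεW := mul_le_mul_of_nonneg_left hw2le hε0.le
  have hLc : 0 ≤ L * (c₁ + c₂) ^ 2 := by positivity
  linarith
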